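/- arXiv:2104.12264 — 2 statements merged into one kernel-verified Lean document; each statement's English description precedes it below -/
import Mathlib

section
/- For every prime p > 3, (p-1)! ≡ −p·B_{p-1}/(p-1) + p·B_{2(p-1)}/(2(p-1)) − (1/2)·(p·B_{p-1}/(p-1))² (mod p³). -/
/-- `a ≡ b (mod p^n)` as rationals: `p^n` divides the numerator of `a - b`,
the denominator being prime to `p`. -/
def rcong (p n : ℕ) (a b : ℚ) : Prop :=
  a = b ∨ (n : ℤ) ≤ padicValRat p (a - b)

open Finset

/-- `p`-integral rationals. -/
def RR (p : ℕ) [Fact p.Prime] : Subring ℚ := (Rat.padicValuation p).integer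

lemma mem_RR {p : ℕ} [Fact p.Prime] {x : ℚ} : x ∈ RR p ↔ ¬ p ∣ x.den := by
  rw [← Rat.padicValuation_le_one_iff]; rfl

lemma inv_mem_RR {p : ℕ} [Fact p.Prime] {m : ℕ} (h : ¬ p ∣ m) : ((m : ℚ))⁻¹ ∈ RR p := by
  rw [mem_RR]
  have : m ≠ 0 := by rintro rfl; simp at h
  simpa [this] using h

lemma pow_div_mem_RR {p : ℕ} [Fact p.Prime] {M N : ℕ} (hM : M ≠ 0) (h : M < p ^ (N + 1)) :
    (p : ℚ) ^ N / M ∈ RR p := by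
  have hp : p.Prime := Fact.out
  obtain ⟨e, m, hm, rfl⟩ := Nat.exists_eq_pow_mul_and_not_dvd hM p hp.ne_one
  have hm0 : 0 < m := Nat.pos_of_ne_zero (by rintro rfl; simp at hm)
  have he : e ≤ N := by
    have h1 : p ^ e < p ^ (N + 1) := lt_of_le_of_lt (Nat.le_mul_of_pos_right _ hm0) h
    have := (Nat.pow_lt_pow_iff_right hp.one_lt).1 h1
    omega
  have hp0 : (p : ℚ) ≠ 0 := by exact_mod_cast hp.ne_zero
  obtain ⟨c, rfl⟩ := Nat.exists_eq_add_of_le he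
  have : (p : ℚ) ^ (e + c) / ((p ^ e * m : ℕ) : ℚ) = (p : ℚ) ^ c * (m : ℚ)⁻¹ := by
    have : (m : ℚ) ≠ 0 := by exact_mod_cast hm0.ne'
    push_cast; rw [pow_add]; field_simp
  rw [this]
  exact mul_mem (pow_mem (natCast_mem _ _) _) (inv_mem_RR hm)

lemma two_inv_mem {p : ℕ} [Fact p.Prime] (h3 : 3 < p) : (2 : ℚ)⁻¹ ∈ RR p := by
  exact_mod_cast inv_mem_RR (p := p) (m := 2) (fun h => by have := Nat.le_of_dvd (by norm_num) h; omega)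

lemma bern_mem {p : ℕ} [Fact p.Prime] {k : ℕ} (h : ¬ (p - 1) ∣ 2 * k) :
    bernoulli (2 * k) ∈ RR p := by
  obtain ⟨z, hz⟩ := Bernoulli.vonStaudt_clausen k
  rw [eq_sub_of_add_eq hz.symm]
  refine sub_mem (intCast_mem _ _) (sum_mem fun q hq => ?_)
  simp only [mem_filter, mem_range] at hq
  rw [one_div]
  refine inv_mem_RR fun hd => ?_
  have := (Nat.prime_dvd_prime_iff_eq Fact.out hq.2.1).1 hd
  subst this
  exact h hq.2.2

lemma p_bern_mem {p : ℕ} [Fact p.Prime] (h3 : 3 < p) (j : ℕ) :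
    (p : ℚ) * bernoulli j ∈ RR p := by
  have hp : p.Prime := Fact.out
  rcases Nat.even_or_odd' j with ⟨k, rfl | rfl⟩
  · obtain ⟨z, hz⟩ := Bernoulli.vonStaudt_clausen k
    rw [eq_sub_of_add_eq hz.symm, mul_sub, mul_sum]
    refine sub_mem (mul_mem (natCast_mem _ _) (intCast_mem _ _)) (sum_mem fun q hq => ?_)
    simp only [mem_filter, mem_range] at hq
    by_cases h : p = q
    · subst h
      have hp0 : (p : ℚ) ≠ 0 := by exact_mod_cast hp.ne_zero
      rw [mul_one_div_cancel hp0]; exact one_mem _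
    · rw [one_div]
      exact mul_mem (natCast_mem _ _) (inv_mem_RR fun hd => h ((Nat.prime_dvd_prime_iff_eq hp hq.2.1).1 hd))
  · rcases Nat.eq_zero_or_pos k with rfl | hk
    · simp only [mul_zero, zero_add, bernoulli_one]
      rw [neg_div, one_div]
      exact mul_mem (natCast_mem _ _) (neg_mem (two_inv_mem h3))
    · rw [bernoulli_eq_zero_of_odd ⟨k, rfl⟩ (by omega), mul_zero]; exact zero_mem _

lemma lt_five_pow (d : ℕ) : d + 4 < 5 ^ (d + 1) := by
  induction d with
  | zero => norm_num
  | succ n ih => rw [pow_succ]; omega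

lemma faul_term {p : ℕ} [Fact p.Prime] (h3 : 3 < p) {k : ℕ} (hk : 4 ≤ k) (hev : Even k)
    (hnd : ¬ (p - 1) ∣ k - 2) {i : ℕ} (hi : i < k) :
    ∃ r ∈ RR p, bernoulli i * ((k + 1).choose i) * (p : ℚ) ^ (k + 1 - i) / (k + 1) = p ^ 3 * r := by
  have hp : p.Prime := Fact.out
  have h5 : 5 ≤ p := by
    by_contra h
    have : p = 4 := by omega
    subst this; revert hp; decide
  obtain ⟨d, rfl⟩ := Nat.exists_eq_add_of_lt hi
  have hch : (((i + d + 1 + 1).choose i : ℕ) : ℚ) / ((i + d + 1 : ℕ) + 1 : ℚ)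
      = ((i + d + 1).choose i : ℚ) / ((d + 2 : ℕ) : ℚ) := by
    rw [div_eq_div_iff (by positivity) (by positivity)]
    have := Nat.choose_mul_succ_eq (i + d + 1) i
    rw [show i + d + 1 + 1 - i = d + 2 by omega] at this
    exact_mod_cast this.symm
  have hrw : bernoulli i * ((i + d + 1 + 1).choose i) * (p : ℚ) ^ (i + d + 1 + 1 - i) / ((i + d + 1 : ℕ) + 1)
      = bernoulli i * ((i + d + 1).choose i) * ((p : ℚ) ^ (d + 2) / ((d + 2 : ℕ) : ℚ)) := by
    rw [show i + d + 1 + 1 - i = d + 2 by omega]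
    calc _ = bernoulli i * (p : ℚ) ^ (d + 2) * ((((i + d + 1 + 1).choose i : ℕ) : ℚ) / ((i + d + 1 : ℕ) + 1 : ℚ)) := by ring
      _ = _ := by rw [hch]; ring
  rw [hrw]
  rcases d with _ | _ | d
  · refine ⟨0, zero_mem _, ?_⟩
    rw [bernoulli_eq_zero_of_odd (by grind) (by omega)]; ring
  · obtain ⟨m, rfl⟩ : ∃ m, i = 2 * m := by
      obtain ⟨c, hc⟩ := hev
      exact ⟨c - 1, by omega⟩
    refine ⟨bernoulli (2 * m) * ((2 * m + (0 + 1) + 1).choose (2 * m) : ℕ) * ((3 : ℕ) : ℚ)⁻¹, ?_, ?_⟩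
    · refine mul_mem (mul_mem (bern_mem ?_) (natCast_mem _ _)) (inv_mem_RR fun h => ?_)
      · simpa using hnd
      · have := Nat.le_of_dvd (by norm_num) h; omega
    · push_cast; ring
  · refine ⟨(p * bernoulli i) * ((i + (d + 1 + 1) + 1).choose i : ℕ) * ((p : ℚ) ^ d / ((d + 4 : ℕ) : ℚ)), ?_, ?_⟩
    · refine mul_mem (mul_mem (p_bern_mem h3 _) (natCast_mem _ _)) (pow_div_mem_RR (by omega) ?_)
      exact (lt_five_pow d).trans_le (Nat.pow_le_pow_left h5 _)
    · ring

lemma power_sum {p : ℕ} [Fact p.Prime] (h3 : 3 < p) {k : ℕ} (hk : 4 ≤ k) (hev : Even k)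
    (hnd : ¬ (p - 1) ∣ k - 2) :
    ∃ r ∈ RR p, (p : ℚ) * bernoulli k = ((∑ v ∈ Ico 1 p, (v : ℤ) ^ k : ℤ) : ℚ) + p ^ 3 * r := by
  have hp : p.Prime := Fact.out
  choose! f hf hf' using fun i (hi : i < k) => faul_term h3 hk hev hnd hi
  refine ⟨- ∑ i ∈ range k, f i, neg_mem (sum_mem fun i hi => hf i (mem_range.1 hi)), ?_⟩
  have h := sum_range_pow p k
  rw [sum_range_succ, sum_congr rfl (fun i hi => hf' i (mem_range.1 hi)), ← mul_sum] at h
  have h0 : ∑ v ∈ range p, (v : ℚ) ^ k = ((∑ v ∈ Ico 1 p, (v : ℤ) ^ k : ℤ) : ℚ) := by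
    rw [range_eq_Ico, sum_eq_sum_Ico_succ_bot hp.pos]
    have : k ≠ 0 := by omega
    push_cast
    simp [this]
  rw [← h0, h]
  have : (k : ℚ) + 1 ≠ 0 := by positivity
  rw [show k + 1 - k = 1 by omega, Nat.choose_succ_self_right]
  push_cast
  field_simp
  ring

lemma prod_cong {ι : Type*} (p : ℤ) (s : Finset ι) (q : ι → ℤ) (h : ∀ i ∈ s, p ∣ q i) :
    p ∣ ∑ i ∈ s, q i ∧ p ^ 2 ∣ ∑ i ∈ s, q i ^ 2 ∧
    p ^ 3 ∣ 2 * ∏ i ∈ s, (1 + q i) - (2 + 2 * ∑ i ∈ s, q i + (∑ i ∈ s, q i) ^ 2 - ∑ i ∈ s, q i ^ 2) := by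
  classical
  induction s using Finset.induction_on with
  | empty => simp
  | insert a s ha ih =>
    obtain ⟨⟨x, hx⟩, ⟨y, hy⟩, ⟨z, hz⟩⟩ := ih fun i hi => h i (mem_insert_of_mem hi)
    obtain ⟨w, hw⟩ := h a (mem_insert_self _ _)
    rw [sum_insert ha, sum_insert ha, prod_insert ha]
    have hz' := eq_add_of_sub_eq hz
    rw [hx, hy] at hz'
    rw [hx, hy, hw]
    refine ⟨⟨w + x, by ring⟩, ⟨w ^ 2 + y, by ring⟩, ⟨(1 + p * w) * z + w * (x ^ 2 - y), ?_⟩⟩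
    linear_combination (1 + p * w) * hz'

/-- The integral core. -/
lemma core {p : ℕ} [Fact p.Prime] (h3 : 3 < p) (S1 S2 : ℤ)
    (hS1 : S1 = ∑ v ∈ Ico 1 p, (v : ℤ) ^ (p - 1))
    (hS2 : S2 = ∑ v ∈ Ico 1 p, (v : ℤ) ^ (2 * (p - 1))) :
    (p : ℤ) ^ 3 ∣ 2 * ((p : ℤ) - 1) ^ 2 * (Nat.factorial (p - 1) : ℤ)
      - (-2 * ((p : ℤ) - 1) * S1 + ((p : ℤ) - 1) * S2 - S1 ^ 2) := by
  have hp : p.Prime := Fact.out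
  have hfl : ∀ v ∈ Ico 1 p, (p : ℤ) ∣ (v : ℤ) ^ (p - 1) - 1 := by
    intro v hv
    rw [mem_Ico] at hv
    have hc : IsCoprime (v : ℤ) p := by
      rw [Nat.isCoprime_iff_coprime]
      exact ((Nat.Prime.coprime_iff_not_dvd hp).2 fun h => by
        have := Nat.le_of_dvd (by omega) h; omega).symm
    exact (Int.ModEq.pow_card_sub_one_eq_one hp hc).symm.dvd
  obtain ⟨t, ht⟩ : ∃ t : ℤ, (Nat.factorial (p - 1) : ℤ) = -(1 + p * t) := by
    have h := ZMod.wilsons_lemma p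
    have h2 : (((Nat.factorial (p - 1) : ℤ) + 1 : ℤ) : ZMod p) = 0 := by push_cast; rw [h]; ring
    obtain ⟨t, ht⟩ := (ZMod.intCast_zmod_eq_zero_iff_dvd _ _).1 h2
    exact ⟨-t, by linear_combination ht⟩
  have hcast : ((p - 1 : ℕ) : ℤ) = (p : ℤ) - 1 := by have := hp.pos; push_cast [Nat.cast_sub this]; rfl
  obtain ⟨⟨e, he⟩, ⟨Q, hQ⟩, ⟨z, hz⟩⟩ := prod_cong (p : ℤ) (Ico 1 p) (fun v => (v : ℤ) ^ (p - 1) - 1) hfl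
  obtain ⟨-, -, ⟨z', hz'⟩⟩ := prod_cong (p : ℤ) (range (p - 1)) (fun _ => (p : ℤ) * t) (fun _ _ => ⟨t, rfl⟩)
  have hprod : ∏ v ∈ Ico 1 p, (1 + ((v : ℤ) ^ (p - 1) - 1)) = ∏ v ∈ range (p - 1), (1 + (p : ℤ) * t) := by
    have hev : Even (p - 1) := hp.even_sub_one (by omega)
    simp only [add_sub_cancel, prod_const, card_range]
    rw [prod_pow, ← hev.neg_pow (1 + (p : ℤ) * t), ← ht]
    congr 1
    rw [← Finset.prod_Ico_id_eq_factorial]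
    rw [show p - 1 + 1 = p from Nat.succ_pred_prime hp]
    push_cast; rfl
  rw [hprod] at hz
  simp only [sum_const, card_range, nsmul_eq_mul, hcast] at hz'
  rw [he, hQ] at hz
  have e1 : S1 = (p : ℤ) - 1 + p * e := by
    rw [hS1, ← he, sum_sub_distrib]; simp [hcast]
  have e2 : S2 = p ^ 2 * Q + 2 * (p * e) + ((p : ℤ) - 1) := by
    rw [← hQ, ← he, hS2, mul_sum, ← hcast]
    have : ((p - 1 : ℕ) : ℤ) = ∑ v ∈ Ico 1 p, (1 : ℤ) := by simp
    rw [this, ← sum_add_distrib, ← sum_add_distrib]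
    refine sum_congr rfl fun v _ => ?_
    ring
  rw [ht, e1, e2]
  have hp0 : (p : ℤ) ≠ 0 := by exact_mod_cast hp.ne_zero
  set n : ℤ := (p : ℤ) - 1 with hn
  -- combined congruence
  have hK : 2 * n * (p * t) + (n ^ 2 - n) * (p * t) ^ 2
      = 2 * (p * e) + (p * e) ^ 2 - p ^ 2 * Q + p ^ 3 * (z - z') := by
    linear_combination hz - hz'
  have hK1 : 2 * (n * t - e) = p * (e ^ 2 - Q + p * (z - z') - (n ^ 2 - n) * t ^ 2) := by
    apply mul_left_cancel₀ hp0
    linear_combination hK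
  obtain ⟨f, hf⟩ : (p : ℤ) ∣ n * t - e := by
    have : IsCoprime (p : ℤ) 2 := by
      have := (Nat.isCoprime_iff_coprime (m := p) (n := 2)).2
        ((Nat.coprime_primes hp Nat.prime_two).2 (by omega))
      exact_mod_cast this
    exact this.dvd_of_dvd_mul_left ⟨_, hK1⟩
  refine ⟨-n * (z - z') + (n - 1) * f * (n * t + e), ?_⟩
  linear_combination (-n) * hK + (n - 1) * (n * t + e) * p ^ 2 * hf

lemma rcong_of {p : ℕ} [Fact p.Prime] {a b r : ℚ} (hr : r ∈ RR p) (h : a - b = p ^ 3 * r) :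
    rcong p 3 a b := by
  have hp : p.Prime := Fact.out
  by_cases h0 : r = 0
  · left; rw [h0, mul_zero] at h; exact sub_eq_zero.1 h
  · right
    have hp0 : (p : ℚ) ≠ 0 := by exact_mod_cast hp.ne_zero
    rw [h, padicValRat.mul (pow_ne_zero _ hp0) h0, padicValRat.pow, padicValRat.self hp.one_lt]
    have : 0 ≤ padicValRat p r := by
      rw [padicValRat_def, padicValNat.eq_zero_of_not_dvd (mem_RR.1 hr)]; simp
    push_cast
    linarith

theorem sun_wilson_mod_p_cubed (p : ℕ) (hp : p.Prime) (hgt : 3 < p) :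
    rcong p 3 ((Nat.factorial (p - 1) : ℚ))
      (-( (p : ℚ) * bernoulli (p - 1)) / ((p : ℚ) - 1)
        + (p : ℚ) * bernoulli (2 * (p - 1)) / (2 * ((p : ℚ) - 1))
        - (1 / 2) * ((p : ℚ) * bernoulli (p - 1) / ((p : ℚ) - 1)) ^ 2) := by
  have : Fact p.Prime := ⟨hp⟩
  have h5 : 5 ≤ p := by
    by_contra h
    have : p = 4 := by omega
    subst this; revert hp; decide
  have hev : Even (p - 1) := hp.even_sub_one (by omega)
  obtain ⟨r1, hr1, h1⟩ := power_sum (p := p) hgt (k := p - 1) (by omega) hev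
    (fun h => by have := Nat.le_of_dvd (by omega) h; omega)
  obtain ⟨r2, hr2, h2⟩ := power_sum (p := p) hgt (k := 2 * (p - 1)) (by omega) (even_two_mul _)
    (fun h => by
      have h' : (p - 1) ∣ p - 3 := by
        rw [show 2 * (p - 1) - 2 = (p - 1) + (p - 3) by omega] at h
        exact (Nat.dvd_add_right (dvd_refl _)).1 h
      have := Nat.le_of_dvd (by omega) h'; omega)
  obtain ⟨c, hc⟩ := core hgt _ _ rfl rfl
  set S1 : ℤ := ∑ v ∈ Ico 1 p, (v : ℤ) ^ (p - 1)
  set S2 : ℤ := ∑ v ∈ Ico 1 p, (v : ℤ) ^ (2 * (p - 1))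
  have hcq : 2 * ((p : ℚ) - 1) ^ 2 * (Nat.factorial (p - 1) : ℚ)
      - (-2 * ((p : ℚ) - 1) * S1 + ((p : ℚ) - 1) * S2 - S1 ^ 2) = p ^ 3 * c := by exact_mod_cast hc
  rw [h1, h2]
  have hn : ((p : ℚ) - 1) ≠ 0 := by
    have : (5 : ℚ) ≤ p := by exact_mod_cast h5
    intro h; linarith
  have hninv : ((p : ℚ) - 1)⁻¹ ∈ RR p := by
    have := inv_mem_RR (p := p) (m := p - 1) (fun h => by have := Nat.le_of_dvd (by omega) h; omega)
    rwa [Nat.cast_sub hp.one_le, Nat.cast_one] at this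
  have hpm : (p : ℚ) ∈ RR p := natCast_mem _ _
  have hnm : (p : ℚ) - 1 ∈ RR p := sub_mem hpm (one_mem _)
  have h2m : (2 : ℚ) ∈ RR p := by exact_mod_cast natCast_mem (RR p) 2
  refine rcong_of (r := (2 : ℚ)⁻¹ * (((p : ℚ) - 1)⁻¹) ^ 2 *
    (c + 2 * ((p : ℚ) - 1) * r1 - ((p : ℚ) - 1) * r2 + (2 * S1 * r1 + p ^ 3 * r1 ^ 2))) ?_ ?_
  · refine mul_mem (mul_mem (two_inv_mem hgt) (pow_mem hninv _)) ?_
    refine add_mem (sub_mem (add_mem (intCast_mem _ _) ?_) (mul_mem hnm hr2)) (add_mem ?_ ?_)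
    · exact mul_mem (mul_mem h2m hnm) hr1
    · exact mul_mem (mul_mem h2m (intCast_mem _ _)) hr1
    · exact mul_mem (pow_mem hpm _) (pow_mem hr1 _)
  · field_simp
    linear_combination hcq
end

section
/- For every prime p > 3, 1/(p-1)! ≡ 3(p·B_{p-1}/(p-1) − 1) − p·B_{2(p-1)}/(2(p-1)) − (1/2)·p²·(B_{p-1}/(p-1))² (mod p³), where 1/(p-1)! denotes the inverse of (p-1)! modulo p³. -/
open Finset in
theorem prodLem (p : ℤ) {ι : Type*} (s : Finset ι) (y : ι → ℤ) (h : ∀ i ∈ s, p ∣ y i) :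
    p ∣ ∑ i ∈ s, y i ∧ p ^ 2 ∣ ∑ i ∈ s, y i ^ 2 ∧
    p ^ 3 ∣ 2 * ∏ i ∈ s, (1 + y i) -
      (2 + 2 * (∑ i ∈ s, y i) + (∑ i ∈ s, y i) ^ 2 - ∑ i ∈ s, y i ^ 2) := by
  classical
  induction s using Finset.induction_on with
  | empty => simp
  | insert a s ha ih =>
    obtain ⟨⟨A, hA⟩, ⟨B, hB⟩, ⟨C, hC⟩⟩ := ih (fun i hi => h i (Finset.mem_insert_of_mem hi))
    obtain ⟨Z, hZ⟩ := h a (Finset.mem_insert_self _ _)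
    rw [Finset.sum_insert ha, Finset.sum_insert ha, Finset.prod_insert ha]
    rw [hA, hB] at *
    refine ⟨⟨Z + A, by rw [hZ]; ring⟩, ⟨Z ^ 2 + B, by rw [hZ]; ring⟩,
      ⟨C * (1 + y a) + Z * (A ^ 2 - B), ?_⟩⟩
    rw [hZ] at *
    linear_combination (1 + p * Z) * hC

theorem intCong (p : ℕ) (hp : p.Prime) (hgt : 3 < p) (u X Y P f : ℤ)
    (hf : f = -(1 + p * u)) (hX : (p : ℤ) ∣ X) (hY : (p : ℤ) ^ 2 ∣ Y)
    (hP : (p : ℤ) ^ 3 ∣ 2 * P - (2 + 2 * X + X ^ 2 - Y))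
    (hfP : f ^ (p - 1) = P) :
    (p : ℤ) ^ 3 ∣ 2 * (p - 1) ^ 2 - f * (6 * (p - 1) * (p - 1 + X) - 6 * (p - 1) ^ 2
      - (p - 1) * (Y + 2 * X + (p - 1)) - (p - 1 + X) ^ 2) := by
  have hp0 : (p : ℤ) ≠ 0 := by exact_mod_cast hp.ne_zero
  have hpp : Prime (p : ℤ) := Nat.prime_iff_prime_int.mp hp
  have heven : Even (p - 1) := hp.even_sub_one (by omega)
  have hc : ((p - 1 : ℕ) : ℤ) = p - 1 := by rw [Nat.cast_sub hp.one_le]; simp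
  obtain ⟨-, -, C', hC'⟩ := prodLem p (Finset.range (p - 1)) (fun _ => (p : ℤ) * u) (by simp)
  simp only [Finset.prod_const, Finset.sum_const, Finset.card_range, nsmul_eq_mul, hc] at hC'
  rw [hf, heven.neg_pow] at hfP
  rw [hfP] at hC'
  obtain ⟨x, rfl⟩ := hX
  obtain ⟨y, rfl⟩ := hY
  obtain ⟨C, hC⟩ := hP
  have h1 : 2 * x + p * x ^ 2 - p * y - 2 * (p - 1) * u - p * (p - 1) * (p - 2) * u ^ 2
      = p ^ 2 * (C' - C) := by
    apply mul_left_cancel₀ hp0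
    linear_combination hC' - hC
  have h2n : ¬ (p : ℤ) ∣ 2 := by
    intro h
    have := Int.le_of_dvd (by norm_num) h
    omega
  have h2 : (p : ℤ) ∣ 2 * (x + u) :=
    ⟨p * (C' - C) - x ^ 2 + y + 2 * u + (p - 1) * (p - 2) * u ^ 2, by linear_combination h1⟩
  obtain ⟨t, ht⟩ := (hpp.dvd_or_dvd h2).resolve_left h2n
  obtain rfl : x = p * t - u := by linear_combination ht
  have h3 : 2 * t + (p * t - u) ^ 2 - y - 2 * u - (p - 1) * (p - 2) * u ^ 2 = p * (C' - C) := by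
    apply mul_left_cancel₀ hp0
    linear_combination h1
  obtain ⟨r, hr⟩ : ∃ r, y = 2 * t - u ^ 2 - 2 * u + p * r :=
    ⟨p * t ^ 2 - 2 * t * u - (p - 3) * u ^ 2 - (C' - C), by linear_combination -h3⟩
  subst hr hf
  exact ⟨-u ^ 2 + 2 * (p - 1) * u * t - (p - 1) * r + 2 * t * u - p * t ^ 2
    - u * ((p - 1) * (2 * t - u ^ 2 - 2 * u + p * r) + (p * t - u) ^ 2), by ring⟩

def EE (p : ℕ) (n : ℕ) (x : ℚ) : Prop := padicNorm p x ≤ (p : ℚ) ^ (-(n : ℤ))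

section
variable {p : ℕ} [hp : Fact p.Prime]

theorem EE.add {n : ℕ} {x y : ℚ} (hx : EE p n x) (hy : EE p n y) : EE p n (x + y) :=
  padicNorm.nonarchimedean.trans (max_le hx hy)
theorem EE.neg {n : ℕ} {x : ℚ} (hx : EE p n x) : EE p n (-x) := by
  unfold EE; rw [padicNorm.neg]; exact hx
theorem EE.sub {n : ℕ} {x y : ℚ} (hx : EE p n x) (hy : EE p n y) : EE p n (x - y) := by
  rw [sub_eq_add_neg]; exact hx.add hy.neg
theorem EE.mul {m n : ℕ} {x y : ℚ} (hx : EE p m x) (hy : EE p n y) : EE p (m + n) (x * y) := by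
  unfold EE at *
  have : (p : ℚ) ≠ 0 := by exact_mod_cast hp.out.ne_zero
  rw [padicNorm.mul, Nat.cast_add, neg_add, zpow_add₀ this]
  exact mul_le_mul hx hy (padicNorm.nonneg _) (by positivity)
theorem EE.mono {m n : ℕ} {x : ℚ} (hx : EE p n x) (h : m ≤ n) : EE p m x := by
  refine hx.trans (zpow_le_zpow_right₀ ?_ (by omega))
  exact_mod_cast hp.out.one_le
theorem EE.int {n : ℕ} {z : ℤ} (h : (p : ℤ) ^ n ∣ z) : EE p n z := by
  have := (padicNorm.dvd_iff_norm_le (p := p) (n := n) (z := z)).mp (by exact_mod_cast h)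
  exact this
theorem EE.int0 (z : ℤ) : EE p 0 z := EE.int (by simp)
theorem EE.nat0 (z : ℕ) : EE p 0 z := by exact_mod_cast EE.int0 (p := p) (z : ℤ)
theorem EE.sum {ι : Type*} {n : ℕ} {s : Finset ι} {f : ι → ℚ} (h : ∀ i ∈ s, EE p n (f i)) :
    EE p n (∑ i ∈ s, f i) := by
  refine padicNorm.sum_le' h ?_
  positivity
/-- cancel a factor of `p` -/
theorem EE.of_p_mul {n : ℕ} {x : ℚ} (h : EE p (n + 1) (p * x)) : EE p n x := by
  unfold EE at *
  have h0 : (0 : ℚ) < p := by exact_mod_cast hp.out.pos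
  rw [padicNorm.mul, padicNorm.padicNorm_p_of_prime, Nat.cast_add, neg_add,
    zpow_add₀ h0.ne', mul_comm] at h
  have : (p : ℚ) ^ (-((1 : ℕ) : ℤ)) = (p : ℚ)⁻¹ := by simp
  rw [this] at h
  exact le_of_mul_le_mul_right h (by positivity)
/-- cancel a unit -/
theorem EE.of_unit_mul {n : ℕ} {x : ℚ} {d : ℤ} (hd : ¬ (p : ℤ) ∣ d) (h : EE p n (d * x)) :
    EE p n x := by
  unfold EE at *
  rwa [padicNorm.mul, (padicNorm.int_eq_one_iff d).mpr hd, one_mul] at h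

theorem EE.pow_div (hgt : 3 < p) (j : ℕ) : EE p (min j 3) ((p : ℚ) ^ j / ((j + 1 : ℕ) : ℚ)) := by
  have h0 : (p : ℚ) ≠ 0 := by exact_mod_cast hp.out.ne_zero
  unfold EE
  have hj : ((j + 1 : ℕ) : ℚ) ≠ 0 := by positivity
  rw [padicNorm.eq_zpow_of_nonzero (by positivity)]
  refine zpow_le_zpow_right₀ (by exact_mod_cast hp.out.one_le) ?_
  rw [padicValRat.div (by positivity) hj, padicValRat.pow, padicValRat.self hp.out.one_lt,
    padicValRat.of_nat]
  have h5 : 5 ≤ p := by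
    rcases Nat.lt_or_ge p 5 with h | h
    · have : p = 4 := by omega
      have := hp.out
      subst_vars
      norm_num at this
    · exact h
  have hle : p ^ padicValNat p (j + 1) ≤ j + 1 := Nat.le_of_dvd (by omega) pow_padicValNat_dvd
  generalize padicValNat p (j + 1) = v at *
  have h5v : 5 ^ v ≤ j + 1 := (Nat.pow_le_pow_left h5 v).trans hle
  have : v * 4 + 1 ≤ 5 ^ v := by
    clear * -
    induction v with
    | zero => simp
    | succ v ih => rw [pow_succ]; omega
  rw [mul_one]
  omega

open Finset

theorem faul (k : ℕ) : (p : ℚ) * bernoulli k = ((∑ v ∈ Ico 1 p, (v : ℤ) ^ k : ℤ) : ℚ)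
    + (if k = 0 then 1 else 0)
    - ∑ i ∈ range k, (p * bernoulli i) * ((k.choose i : ℕ) : ℚ) *
      ((p : ℚ) ^ (k - i) / ((k - i + 1 : ℕ) : ℚ)) := by
  have h := sum_range_pow p k
  rw [sum_range_succ, range_eq_Ico (a := p), sum_eq_sum_Ico_succ_bot hp.out.pos] at h
  have h2 : bernoulli k * ((k + 1).choose k : ℕ) * (p : ℚ) ^ (k + 1 - k) / (k + 1)
      = p * bernoulli k := by
    have : (k : ℚ) + 1 ≠ 0 := by positivity
    simp
    field_simp
  rw [h2] at h
  have h3 : ((0 : ℕ) : ℚ) ^ k = if k = 0 then 1 else 0 := by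
    split_ifs with hk <;> simp [hk]
  rw [h3] at h
  have h4 : ∑ i ∈ range k, bernoulli i * ((k + 1).choose i : ℕ) * (p : ℚ) ^ (k + 1 - i) / (k + 1)
     = ∑ i ∈ range k, (p * bernoulli i) * ((k.choose i : ℕ) : ℚ) *
      ((p : ℚ) ^ (k - i) / ((k - i + 1 : ℕ) : ℚ)) := by
    refine sum_congr rfl fun i hi => ?_
    rw [mem_range] at hi
    have e : k + 1 - i = k - i + 1 := by omega
    have hc := Nat.choose_mul_succ_eq k i
    rw [e] at hc
    have hc' : (k.choose i : ℚ) * (k + 1) = (k + 1).choose i * ((k - i + 1 : ℕ) : ℚ) := by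
      exact_mod_cast hc
    rw [e, pow_succ]
    have h1 : (k : ℚ) + 1 ≠ 0 := by positivity
    have h2 : ((k - i + 1 : ℕ) : ℚ) ≠ 0 := by positivity
    rw [div_eq_iff h1, mul_div_assoc', div_mul_eq_mul_div, eq_div_iff h2]
    linear_combination -(bernoulli i * (p : ℚ) ^ (k - i) * p) * hc'
  rw [h4] at h
  push_cast at h ⊢
  linarith

theorem pB_int (hgt : 3 < p) (k : ℕ) : EE p 0 (p * bernoulli k) := by
  induction k using Nat.strong_induction_on with
  | _ k ih =>
    rw [faul]
    refine ((EE.int0 _).add ?_).sub (EE.sum fun i hi => ?_)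
    · split_ifs
      · exact_mod_cast EE.int0 (p := p) 1
      · exact_mod_cast EE.int0 (p := p) 0
    · exact ((((ih i (mem_range.mp hi)).mul (EE.nat0 _))).mul (EE.pow_div hgt (k - i))).mono (by simp)

theorem powsum (l : ℕ) :
    ((∑ v ∈ Ico 1 p, (v : ℤ) ^ l : ℤ) : ZMod p) = if (p - 1) ∣ l then -1 else 0 := by
  have hbij : (∑ v ∈ Ico 1 p, (v : ZMod p) ^ l) = ∑ u : (ZMod p)ˣ, (u : ZMod p) ^ l :=
    Finset.sum_bij'
      (fun v hv ↦ Units.mk0 (v : ZMod p) (mt (ZMod.natCast_eq_zero_iff v p).mp (by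
        grind [Nat.not_dvd_of_pos_of_lt])))
      (fun u _ ↦ (u : ZMod p).val)
      (fun _ _ ↦ Finset.mem_univ _)
      (fun u _ ↦ by grind [u.ne_zero, ZMod.val_ne_zero, ZMod.val_lt])
      (fun v hv ↦ by simp [ZMod.val_cast_of_lt (Finset.mem_Ico.mp hv).2])
      (fun u _ ↦ Units.ext (ZMod.natCast_zmod_val _))
      (fun _ _ ↦ rfl)
  push_cast
  rw [hbij, FiniteField.sum_pow_units, ZMod.card]

theorem B_int (hgt : 3 < p) (k : ℕ) (hk : ¬ (p - 1) ∣ k) : EE p 0 (bernoulli k) := by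
  apply EE.of_p_mul
  have hk0 : k ≠ 0 := by rintro rfl; simp at hk
  rw [faul, if_neg hk0, add_zero]
  refine EE.sub (EE.int ?_) (EE.sum fun i hi => ?_)
  · have := powsum (p := p) k
    rw [if_neg hk, ZMod.intCast_zmod_eq_zero_iff_dvd] at this
    simpa using this
  · rw [mem_range] at hi
    exact (((pB_int hgt i).mul (EE.nat0 _)).mul (EE.pow_div hgt (k - i))).mono (by omega)

theorem pB_cong (hgt : 3 < p) (k : ℕ) (hk : Even k) (h4 : 4 ≤ k) (hk2 : ¬ (p - 1) ∣ k - 2) :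
    EE p 3 (p * bernoulli k - ((∑ v ∈ Ico 1 p, (v : ℤ) ^ k : ℤ) : ℚ)) := by
  rw [faul, if_neg (by omega), add_zero, sub_sub_cancel_left]
  refine (EE.sum fun i hi => ?_).neg
  rw [mem_range] at hi
  obtain h | h | h : i = k - 1 ∨ i = k - 2 ∨ 3 ≤ k - i := by omega
  · rw [h, bernoulli_eq_zero_of_odd (Nat.Even.sub_odd (by omega) hk odd_one) (by omega)]
    simpa using EE.int (p := p) (n := 3) (z := 0) (by simp)
  · have hp1 : EE p 1 (p : ℚ) := by exact_mod_cast EE.int (p := p) (n := 1) (z := p) (by simp)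
    have hB := B_int hgt i (by rwa [h])
    exact (((hp1.mul hB).mul (EE.nat0 _)).mul (EE.pow_div hgt (k - i))).mono (by omega)
  · exact (((pB_int hgt i).mul (EE.nat0 _)).mul (EE.pow_div hgt (k - i))).mono (by omega)
end

set_option maxHeartbeats 1000000 in
open Finset in
theorem inverse_factorial_mod_p_cubed (p : ℕ) (hp : p.Prime) (hgt : 3 < p) :
    rcong p 3 (1 / (Nat.factorial (p - 1) : ℚ))
      (3 * ((p : ℚ) * bernoulli (p - 1) / ((p : ℚ) - 1) - 1)
        - (p : ℚ) * bernoulli (2 * (p - 1)) / (2 * ((p : ℚ) - 1))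
        - (1 / 2) * (p : ℚ) ^ 2 * (bernoulli (p - 1) / ((p : ℚ) - 1)) ^ 2) := by
  have : Fact p.Prime := ⟨hp⟩
  have hp1 : ((p - 1 : ℕ) : ℤ) = p - 1 := by rw [Nat.cast_sub hp.one_le]; simp
  have hpodd : Even (p - 1) := hp.even_sub_one (by omega)
  have hpp : Prime (p : ℤ) := Nat.prime_iff_prime_int.mp hp
  -- reduction to `EE`
  suffices H : EE p 3 (1 / (Nat.factorial (p - 1) : ℚ) -
      (3 * ((p : ℚ) * bernoulli (p - 1) / ((p : ℚ) - 1) - 1)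
        - (p : ℚ) * bernoulli (2 * (p - 1)) / (2 * ((p : ℚ) - 1))
        - (1 / 2) * (p : ℚ) ^ 2 * (bernoulli (p - 1) / ((p : ℚ) - 1)) ^ 2)) by
    unfold rcong
    rw [← sub_eq_zero]
    by_cases h0 : 1 / (Nat.factorial (p - 1) : ℚ) -
      (3 * ((p : ℚ) * bernoulli (p - 1) / ((p : ℚ) - 1) - 1)
        - (p : ℚ) * bernoulli (2 * (p - 1)) / (2 * ((p : ℚ) - 1))
        - (1 / 2) * (p : ℚ) ^ 2 * (bernoulli (p - 1) / ((p : ℚ) - 1)) ^ 2) = 0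
    · exact Or.inl h0
    · right
      unfold EE at H
      rw [padicNorm.eq_zpow_of_nonzero h0,
        zpow_le_zpow_iff_right₀ (by exact_mod_cast hp.one_lt)] at H
      linarith
  -- Wilson and Fermat
  obtain ⟨u, hu⟩ : ∃ u : ℤ, ((p - 1).factorial : ℤ) = -(1 + p * u) := by
    have hw := ZMod.wilsons_lemma p
    have : (((p - 1).factorial + 1 : ℤ) : ZMod p) = 0 := by push_cast; rw [hw]; ring
    rw [ZMod.intCast_zmod_eq_zero_iff_dvd] at this
    obtain ⟨c, hc⟩ := this
    exact ⟨-c, by linear_combination hc⟩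
  have hy : ∀ v ∈ Ico 1 p, (p : ℤ) ∣ (v : ℤ) ^ (p - 1) - 1 := by
    intro v hv
    rw [mem_Ico] at hv
    rw [← ZMod.intCast_zmod_eq_zero_iff_dvd]
    push_cast
    rw [ZMod.pow_card_sub_one_eq_one, sub_self]
    rw [Ne, ZMod.natCast_eq_zero_iff]
    exact Nat.not_dvd_of_pos_of_lt (by omega) hv.2
  obtain ⟨hX, hY, hP⟩ := prodLem p (Ico 1 p) (fun v => (v : ℤ) ^ (p - 1) - 1) hy
  have hprod : ((p - 1).factorial : ℤ) ^ (p - 1)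
      = ∏ v ∈ Ico 1 p, (1 + ((v : ℤ) ^ (p - 1) - 1)) := by
    simp only [add_sub_cancel]
    rw [prod_pow]
    congr 1
    have := Finset.prod_Ico_id_eq_factorial (p - 1)
    rw [Nat.sub_add_cancel hp.one_le] at this
    rw [← this]
    push_cast
    rfl
  have key := intCong p hp hgt u _ _ _ _ hu hX hY hP hprod
  have hs1 : (p : ℤ) - 1 + ∑ v ∈ Ico 1 p, ((v : ℤ) ^ (p - 1) - 1)
      = ∑ v ∈ Ico 1 p, (v : ℤ) ^ (p - 1) := by
    rw [sum_sub_distrib]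
    simp [hp1]
  have hs2 : ∑ v ∈ Ico 1 p, ((v : ℤ) ^ (p - 1) - 1) ^ 2
      + 2 * ∑ v ∈ Ico 1 p, ((v : ℤ) ^ (p - 1) - 1) + ((p : ℤ) - 1)
      = ∑ v ∈ Ico 1 p, (v : ℤ) ^ (2 * (p - 1)) := by
    have : ((p : ℤ) - 1) = ∑ v ∈ Ico 1 p, (1 : ℤ) := by simp [hp1]
    rw [this, mul_sum, ← sum_add_distrib, ← sum_add_distrib]
    refine sum_congr rfl fun v _ => ?_
    rw [mul_comm 2, pow_mul]
    ring
  rw [hs1, hs2] at key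
  have ca := pB_cong hgt (p - 1) hpodd (by
    rcases hpodd with ⟨c, hc⟩; omega) (by
    intro h
    have := Nat.le_of_dvd (by omega) h
    omega)
  have cb := pB_cong hgt (2 * (p - 1)) (by simp) (by omega) (by
    intro h
    have e : 2 * (p - 1) - 2 = (p - 1) + (p - 1 - 2) := by omega
    rw [e, Nat.dvd_add_right (dvd_refl _)] at h
    have := Nat.le_of_dvd (by omega) h
    omega)
  have ia := pB_int hgt (p - 1)
  generalize (∑ v ∈ Ico 1 p, (v : ℤ) ^ (p - 1)) = s1 at *
  generalize (∑ v ∈ Ico 1 p, (v : ℤ) ^ (2 * (p - 1))) = s2 at *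
  generalize bernoulli (p - 1) = B1 at *
  generalize bernoulli (2 * (p - 1)) = B2 at *
  have hfne : ((p - 1).factorial : ℚ) ≠ 0 := by positivity
  have hfd : ¬ (p : ℤ) ∣ ((p - 1).factorial : ℤ) := by
    rw [Int.natCast_dvd_natCast, hp.dvd_factorial]
    omega
  generalize (p - 1).factorial = f at *
  have hmne : (p : ℚ) - 1 ≠ 0 := by
    have : (3 : ℚ) < p := by exact_mod_cast hgt
    linarith
  have hd : ¬ (p : ℤ) ∣ 2 * ((p : ℤ) - 1) ^ 2 * f := by
    intro h
    rcases hpp.dvd_or_dvd h with h | h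
    · rcases hpp.dvd_or_dvd h with h | h
      · have := Int.le_of_dvd (by norm_num) h
        omega
      · have := Int.le_of_dvd (by omega) (hpp.dvd_of_dvd_pow h)
        omega
    · exact hfd h
  apply EE.of_unit_mul hd
  have h1 := EE.int key
  push_cast at h1 ⊢
  have e : (2 * ((p : ℚ) - 1) ^ 2 * f) * (1 / (f : ℚ) -
      (3 * ((p : ℚ) * B1 / ((p : ℚ) - 1) - 1)
        - (p : ℚ) * B2 / (2 * ((p : ℚ) - 1))
        - (1 / 2) * (p : ℚ) ^ 2 * (B1 / ((p : ℚ) - 1)) ^ 2))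
      = (2 * ((p : ℚ) - 1) ^ 2 - f * (6 * (p - 1) * s1 - 6 * (p - 1) ^ 2
      - (p - 1) * s2 - s1 ^ 2))
      - (p * B1 - s1) * ((f * (6 * (p - 1)) : ℤ) : ℚ)
      + (p * B2 - s2) * ((f * (p - 1) : ℤ) : ℚ)
      + (p * B1 - s1) * ((f : ℤ) * (p * B1 + s1)) := by
    push_cast
    field_simp
    ring
  rw [e]
  exact ((h1.sub (ca.mul (EE.int0 _))).add (cb.mul (EE.int0 _))).add
    (ca.mul ((EE.int0 _).mul (ia.add (EE.int0 _))))
end
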